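/- Let K be an algebraically closed field of characteristic 0 and let α ∈ K^× be such that F = Z⁶ + X⁵·Y + X·Y⁵ + α·Z³·X³ is nonsingular. Then Aut(F) is cyclic of order 3, generated by the class of diag(1,1,ω), where ω ∈ K is a primitive third root of unity. -/

import Mathlib

open MvPolynomial Matrix

noncomputable section

variable {K : Type*} [Field K]

/-- The substitution `F ∘ A`, i.e. `X i ↦ ∑ j, A i j • X j`. -/
def substPoly (A : Matrix (Fin 3) (Fin 3) K) (F : MvPolynomial (Fin 3) K) :
    MvPolynomial (Fin 3) K :=
  aeval (fun i => ∑ j, A i j • X j) F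

lemma substPoly_one (F : MvPolynomial (Fin 3) K) : substPoly 1 F = F := by
  have h : (fun i => ∑ j, (1 : Matrix (Fin 3) (Fin 3) K) i j • X j)
      = (X : Fin 3 → MvPolynomial (Fin 3) K) := by
    funext i
    simp [Matrix.one_apply, ite_smul]
  rw [substPoly, h]
  exact aeval_X_left_apply F

lemma substPoly_smul (A : Matrix (Fin 3) (Fin 3) K) (c : K) (F : MvPolynomial (Fin 3) K) :
    substPoly A (c • F) = c • substPoly A F := by
  unfold substPoly
  exact _root_.map_smul (aeval fun i => ∑ j, A i j • X j) c F

lemma substPoly_mul (A B : Matrix (Fin 3) (Fin 3) K) (F : MvPolynomial (Fin 3) K) :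
    substPoly (A * B) F = substPoly B (substPoly A F) := by
  have hfun : (fun i => ∑ j, (A * B) i j • (X j : MvPolynomial (Fin 3) K))
      = fun i => (aeval fun i => (∑ j, B i j • X j : MvPolynomial (Fin 3) K))
          (∑ j, A i j • X j : MvPolynomial (Fin 3) K) := by
    funext i
    rw [map_sum]
    simp only [_root_.map_smul, aeval_X, Matrix.mul_apply, Finset.sum_smul, Finset.smul_sum, smul_smul]
    exact Finset.sum_comm
  have h1 : substPoly (A * B) F
      = aeval (fun i => (aeval fun i => (∑ j, B i j • X j : MvPolynomial (Fin 3) K))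
          (∑ j, A i j • X j : MvPolynomial (Fin 3) K)) F := by
    unfold substPoly
    exact congrArg
      (fun f => (aeval f : MvPolynomial (Fin 3) K →ₐ[K] MvPolynomial (Fin 3) K) F) hfun
  rw [h1, ← MvPolynomial.comp_aeval]
  rfl

/-- The subgroup of `GL₃(K)` preserving the polynomial `F` up to scalar. -/
def autGL (F : MvPolynomial (Fin 3) K) : Subgroup (GL (Fin 3) K) where
  carrier := {A | ∃ c : Kˣ, substPoly (A : Matrix (Fin 3) (Fin 3) K) F = (c : K) • F}
  one_mem' := ⟨1, by simp [substPoly_one]⟩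
  mul_mem' := by
    rintro A B ⟨c, hc⟩ ⟨e, he⟩
    refine ⟨c * e, ?_⟩
    have hAB : ((A * B : GL (Fin 3) K) : Matrix (Fin 3) (Fin 3) K)
        = (A : Matrix (Fin 3) (Fin 3) K) * (B : Matrix (Fin 3) (Fin 3) K) := rfl
    rw [hAB, substPoly_mul, hc, substPoly_smul, he, smul_smul, ← Units.val_mul]
  inv_mem' := by
    rintro A ⟨c, hc⟩
    refine ⟨c⁻¹, ?_⟩
    have key : (c : K) • substPoly ((A⁻¹ : GL (Fin 3) K) : Matrix (Fin 3) (Fin 3) K) F = F := by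
      rw [← substPoly_smul, ← hc, ← substPoly_mul]
      have h1 : (A : Matrix (Fin 3) (Fin 3) K) *
          ((A⁻¹ : GL (Fin 3) K) : Matrix (Fin 3) (Fin 3) K) = 1 := by
        exact_mod_cast Units.mul_inv A
      rw [h1, substPoly_one]
    calc substPoly ((A⁻¹ : GL (Fin 3) K) : Matrix (Fin 3) (Fin 3) K) F
        = ((c : K)⁻¹ * (c : K)) •
            substPoly ((A⁻¹ : GL (Fin 3) K) : Matrix (Fin 3) (Fin 3) K) F := by
          rw [inv_mul_cancel₀ (Units.ne_zero c), one_smul]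
      _ = (c : K)⁻¹ • ((c : K) •
            substPoly ((A⁻¹ : GL (Fin 3) K) : Matrix (Fin 3) (Fin 3) K) F) := by
          rw [smul_smul]
      _ = (c : K)⁻¹ • F := by rw [key]
      _ = ((c⁻¹ : Kˣ) : K) • F := by rw [Units.val_inv_eq_inv_val]

/-- `PGL₃(K)`: the quotient of `GL₃(K)` by its center (the scalar matrices). -/
abbrev PGL3 (K : Type*) [Field K] := GL (Fin 3) K ⧸ Subgroup.center (GL (Fin 3) K)

/-- The automorphism group of the plane curve `F = 0`, as a subgroup of `PGL₃(K)`: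
the classes of matrices `A` with `F ∘ A = λ • F` for some `λ ∈ Kˣ`. -/
def projAut (F : MvPolynomial (Fin 3) K) : Subgroup (PGL3 K) :=
  (autGL F).map (QuotientGroup.mk' (Subgroup.center (GL (Fin 3) K)))

/-- `F` is nonsingular: the only common zero of its partial derivatives is the origin. -/
def IsNonsingular (F : MvPolynomial (Fin 3) K) : Prop :=
  ∀ x : Fin 3 → K, (∀ i, eval x (pderiv i F) = 0) → x = 0

/-- `F` and `G` are projectively equivalent: `F ∘ A = λ • G` for some `A ∈ GL₃(K)`, `λ ∈ Kˣ`. -/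
def ProjEquiv (F G : MvPolynomial (Fin 3) K) : Prop :=
  ∃ A : GL (Fin 3) K, ∃ c : Kˣ,
    substPoly (A : Matrix (Fin 3) (Fin 3) K) F = (c : K) • G


lemma eval_substPoly (A : Matrix (Fin 3) (Fin 3) K) (F : MvPolynomial (Fin 3) K) (x : Fin 3 → K) :
    eval x (substPoly A F) = eval (A *ᵥ x) F := by
  unfold substPoly
  induction F using MvPolynomial.induction_on with
  | C a => simp
  | add p q hp hq => simp only [map_add, hp, hq]
  | mul_X p i hp =>
    simp only [map_mul, hp, aeval_X, eval_X, map_sum, smul_eval]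
    rfl

lemma pderiv_substPoly (A : Matrix (Fin 3) (Fin 3) K) (F : MvPolynomial (Fin 3) K) (j : Fin 3) :
    pderiv j (substPoly A F) = ∑ i, A i j • substPoly A (pderiv i F) := by
  unfold substPoly
  induction F using MvPolynomial.induction_on with
  | C a => simp
  | add p q hp hq => simp only [map_add, hp, hq, smul_add, Finset.sum_add_distrib]
  | mul_X p i hp =>
    simp only [map_mul, aeval_X, Derivation.leibniz, hp, map_sum, Derivation.map_smul,
      pderiv_X, smul_eq_mul, map_add, Pi.single_apply]
    fin_cases i <;> fin_cases j <;> simp [Fin.sum_univ_three, MvPolynomial.smul_eq_C_mul] <;> ring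

/-- The Hessian matrix of `F`. -/
def hess (F : MvPolynomial (Fin 3) K) (x : Fin 3 → K) : Matrix (Fin 3) (Fin 3) K :=
  Matrix.of fun i j => eval x (pderiv i (pderiv j F))

lemma hess_substPoly (A : Matrix (Fin 3) (Fin 3) K) (F : MvPolynomial (Fin 3) K) (x : Fin 3 → K) :
    hess (substPoly A F) x = Aᵀ * hess F (A *ᵥ x) * A := by
  ext i j
  simp only [hess, Matrix.of_apply, pderiv_substPoly, map_sum, Derivation.map_smul, smul_eval,
    eval_substPoly, Matrix.mul_apply, Matrix.transpose_apply, Finset.mul_sum, Finset.sum_mul]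
  refine Finset.sum_congr rfl fun k _ => Finset.sum_congr rfl fun l _ => ?_
  ring

lemma hess_F (α : K) (x : Fin 3 → K) :
    hess (X 2 ^ 6 + X 0 ^ 5 * X 1 + X 0 * X 1 ^ 5 + C α * X 2 ^ 3 * X 0 ^ 3) x =
    !![20 * x 0 ^ 3 * x 1 + 6 * α * x 2 ^ 3 * x 0, 5 * x 0 ^ 4 + 5 * x 1 ^ 4,
        9 * α * x 2 ^ 2 * x 0 ^ 2;
      5 * x 0 ^ 4 + 5 * x 1 ^ 4, 20 * x 0 * x 1 ^ 3, 0;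
      9 * α * x 2 ^ 2 * x 0 ^ 2, 0, 30 * x 2 ^ 4 + 6 * α * x 2 * x 0 ^ 3] := by
  have hn : ∀ (i : Fin 3) (n : ℕ) [n.AtLeastTwo],
      pderiv i (OfNat.ofNat n : MvPolynomial (Fin 3) K) = 0 := by
    intro i n _
    exact Derivation.map_natCast (pderiv i) n
  ext i j
  fin_cases i <;> fin_cases j <;>
    simp [hess, hn, Derivation.leibniz, Derivation.leibniz_pow, pderiv_X, Pi.single_apply] <;> ring

lemma key (α : K) [CharZero K] (hα : α ≠ 0) (A B : Matrix (Fin 3) (Fin 3) K) (c : K) (hc : c ≠ 0)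
    (hAB : A * B = 1) (hBA : B * A = 1)
    (h : substPoly A (X 2 ^ 6 + X 0 ^ 5 * X 1 + X 0 * X 1 ^ 5 + C α * X 2 ^ 3 * X 0 ^ 3)
      = c • (X 2 ^ 6 + X 0 ^ 5 * X 1 + X 0 * X 1 ^ 5 + C α * X 2 ^ 3 * X 0 ^ 3)) :
    ∃ a z : K, a ≠ 0 ∧ z ^ 3 = a ^ 3 ∧ A = Matrix.diagonal ![a, a, z] := by
  have hf : ∀ x : Fin 3 → K, _ := fun x => congrArg (eval x) h
  simp only [eval_substPoly, smul_eval] at hf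
  have hH : ∀ x : Fin 3 → K, _ := fun x => congrArg (fun G => hess G x) h
  have hs : ∀ (G : MvPolynomial (Fin 3) K) x, hess (c • G) x = c • hess G x := by
    intro G x
    ext i j
    simp [hess, Derivation.map_smul]
  simp only [hess_substPoly, hs, hess_F] at hH
  have hB' : Bᵀ * Aᵀ = 1 := by rw [← Matrix.transpose_mul, hAB, Matrix.transpose_one]
  have hv : A *ᵥ ![0, 0, 1] = fun i => A i 2 := by
    ext i; simp [Matrix.mulVec, dotProduct, Fin.sum_univ_three]
  -- Hessian at `v = A e₃`
  have h1 := congrArg (fun M => Bᵀ * M * B) (hH ![0, 0, 1])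
  have e1 : ∀ M : Matrix (Fin 3) (Fin 3) K, Bᵀ * (Aᵀ * M * A) * B = M := by
    intro M
    calc Bᵀ * (Aᵀ * M * A) * B = (Bᵀ * Aᵀ) * M * (A * B) := by simp only [Matrix.mul_assoc]
      _ = M := by rw [hB', hAB]; simp
  simp only [e1, hv] at h1
  have h1' := fun i j => congrFun (congrFun h1 i) j
  simp only [Matrix.mul_apply, Fin.sum_univ_three, Matrix.transpose_apply] at h1'
  have q00 := h1' 0 0
  have q01 := h1' 0 1
  have q02 := h1' 0 2
  have q11 := h1' 1 1
  have q12 := h1' 1 2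
  have q22 := h1' 2 2
  simp at q00 q01 q02 q11 q12 q22
  have hy : B 2 1 = 0 := by
    by_contra hy
    have hB2 : B 2 2 = 0 := by tauto
    -- z = 0
    simp only [hB2] at q02 q22
    have hz : A 2 2 = 0 := by
      by_contra hz
      have hx : A 0 2 = 0 := by
        by_contra hx
        simp [hx, hz, hα] at q02
      simp [hx, hz] at q22
    have hx : A 0 2 ≠ 0 := by
      intro hx
      simp [hx, hc, hy] at q11
    -- second condition
    have cond : ∀ s : K, A 0 2 ^ 2 * (20 * B 2 1 ^ 3 * (- B 2 0) + 6 * α * s ^ 3 * B 2 1)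
        + 2 * A 0 2 * A 1 2 * (5 * B 2 1 ^ 4 + 5 * B 2 0 ^ 4)
        + A 1 2 ^ 2 * (20 * B 2 1 * (- B 2 0) ^ 3) = 0 := by
      intro s
      have h2 := congrFun (congrFun (hH (B *ᵥ ![B 2 1, - B 2 0, s])) 2) 2
      have h3 : (B *ᵥ ![B 2 1, - B 2 0, s]) 2 = 0 := by
        simp [Matrix.mulVec, dotProduct, Fin.sum_univ_three, hB2]; ring
      rw [Matrix.mulVec_mulVec, hAB, Matrix.one_mulVec] at h2
      simp only [Matrix.mul_apply, Fin.sum_univ_three, Matrix.transpose_apply] at h2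
      simp [h3, hz] at h2
      linear_combination h2
    have c0 := cond 0
    have c1 := cond 1
    have : 6 * α * A 0 2 ^ 2 * B 2 1 = 0 := by linear_combination c1 - c0
    simp [hα, hx, hy] at this
  simp only [hy] at q01 q11
  have hx : A 0 2 = 0 := by
    by_contra hx
    have : A 1 2 = 0 := by simpa [hx] using q11
    simp [this, hx] at q01
  have hy2 : A 1 2 = 0 := by
    simpa [hx] using q01
  have hB0 : B 2 0 = 0 := by
    simpa [hx, hc] using q00
  have r := fun i j => congrFun (congrFun hBA i) j
  simp only [Matrix.mul_apply, Fin.sum_univ_three] at r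
  have r20 := r 2 0
  have r21 := r 2 1
  have r22 := r 2 2
  simp [hy, hB0] at r20 r21 r22
  have hB22 : B 2 2 ≠ 0 := by rintro h; simp [h] at r22
  have hz : A 2 2 ≠ 0 := by rintro h; simp [h] at r22
  have ha20 : A 2 0 = 0 := by tauto
  have ha21 : A 2 1 = 0 := by tauto
  have g : ∀ p q t : K, _ := fun p q t => hf ![p, q, t]
  simp [Matrix.mulVec, dotProduct, Fin.sum_univ_three, hx, hy2, ha20, ha21] at g
  have g001 := g 0 0 1
  have g010 := g 0 1 0
  have g011 := g 0 1 1
  have g100 := g 1 0 0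
  have g101 := g 1 0 1
  simp at g001 g010 g011 g100 g101
  have hb : A 0 1 = 0 := by
    have : α * A 2 2 ^ 3 * A 0 1 ^ 3 = 0 := by linear_combination g011 - g010 - g001
    simpa [hα, hz] using this
  have ha3 : A 2 2 ^ 3 = A 0 0 ^ 3 := by
    have : α * A 2 2 ^ 3 * (A 2 2 ^ 3 - A 0 0 ^ 3) = 0 := by
      linear_combination - g101 + g100 + (1 + α) * g001
    have : A 2 2 ^ 3 - A 0 0 ^ 3 = 0 := by simpa [hα, hz] using this
    linear_combination this
  have ha : A 0 0 ≠ 0 := by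
    intro h0
    rw [h0] at ha3
    exact hz (by simpa using ha3)
  have hdet : A.det ≠ 0 := by
    intro h0
    have := congrArg Matrix.det hAB
    simp [h0] at this
  have he : A 1 1 ≠ 0 := by
    intro h0
    apply hdet
    rw [Matrix.det_fin_three]
    simp [hb, h0, hx, hy2]
  have k := fun p q => congrFun (congrFun (hH ![p, q, 0]) 1) 1
  simp only [Matrix.mul_apply, Fin.sum_univ_three, Matrix.transpose_apply] at k
  simp [Matrix.mulVec, dotProduct, Fin.sum_univ_three, hx, hy2, ha20, ha21, hb] at k
  have k10 := k 1 0
  have k11 := k 1 1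
  have hd : A 1 0 = 0 := by
    simpa [ha, he] using k10
  have hE : A 0 0 * A 1 1 ^ 5 = c := by
    have : (20 : K) * (A 0 0 * A 1 1 ^ 5 - c) = 0 := by
      simp [hd] at k11
      linear_combination k11
    have := (mul_eq_zero.mp this).resolve_left (by norm_num)
    linear_combination this
  have g110 := g 1 1 0
  simp [hd, hb] at g110
  have hE2 : A 0 0 ^ 5 * A 1 1 = c := by linear_combination g110 - hE
  have hae : A 1 1 = A 0 0 := by
    have : A 0 0 ^ 5 * (A 1 1 - A 0 0) = 0 := by
      linear_combination hE2 - g001 + (A 2 2 ^ 3 + A 0 0 ^ 3) * ha3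
    have := (mul_eq_zero.mp this).resolve_left (pow_ne_zero _ ha)
    linear_combination this
  refine ⟨A 0 0, A 2 2, ha, ha3, ?_⟩
  ext i j
  fin_cases i <;> fin_cases j <;> simp [hb, hx, hy2, ha20, ha21, hd, hae]

lemma mem_center_of_scalar (S : GL (Fin 3) K) (a : K)
    (h : (S : Matrix (Fin 3) (Fin 3) K) = a • 1) : S ∈ Subgroup.center (GL (Fin 3) K) := by
  rw [Subgroup.mem_center_iff]
  intro g
  apply Units.ext
  simp [h]

lemma diag_notMem_center (ω : K) (hω : ω ≠ 1) (A : GL (Fin 3) K)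
    (hA : (A : Matrix (Fin 3) (Fin 3) K) = Matrix.diagonal ![1, 1, ω]) :
    A ∉ Subgroup.center (GL (Fin 3) K) := by
  intro h
  rw [Subgroup.mem_center_iff] at h
  let T : Matrix (Fin 3) (Fin 3) K := !![1, 0, 1; 0, 1, 0; 0, 0, 1]
  have hT : T.det ≠ 0 := by simp [T, Matrix.det_fin_three]
  have h1 := congrArg (fun g : GL (Fin 3) K => (g : Matrix (Fin 3) (Fin 3) K) 0 2)
    (h (Matrix.GeneralLinearGroup.mkOfDetNeZero T hT))
  simp [hA, Matrix.GeneralLinearGroup.mkOfDetNeZero, T] at h1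
  exact hω h1

/-- for `α ≠ 0` with `F = Z⁶ + X⁵Y + XY⁵ + α·Z³X³` nonsingular,
`Aut(F)` is cyclic of order 3, generated by the class of `diag(1,1,ω)`. -/
theorem stmt18 {K : Type*} [Field K] [IsAlgClosed K] [CharZero K]
    (α : K) (hα : α ≠ 0)
    (F : MvPolynomial (Fin 3) K)
    (hF : F = X 2 ^ 6 + X 0 ^ 5 * X 1 + X 0 * X 1 ^ 5 + C α * X 2 ^ 3 * X 0 ^ 3)
    (hns : IsNonsingular F)
    (ω : K) (hω : IsPrimitiveRoot ω 3)
    (A : GL (Fin 3) K)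
    (hA : (A : Matrix (Fin 3) (Fin 3) K) = Matrix.diagonal ![1, 1, ω]) :
    projAut F
      = Subgroup.zpowers (QuotientGroup.mk' (Subgroup.center (GL (Fin 3) K)) A) ∧
    Nat.card ↥(projAut F) = 3 := by
  have hval : ∀ n : ℕ, ((A ^ n : GL (Fin 3) K) : Matrix (Fin 3) (Fin 3) K)
      = Matrix.diagonal ![1, 1, ω ^ n] := by
    intro n
    rw [Units.val_pow_eq_pow_val, hA, Matrix.diagonal_pow]
    congr 1
    ext i; fin_cases i <;> simp
  have hord : orderOf (QuotientGroup.mk' (Subgroup.center (GL (Fin 3) K)) A) = 3 := by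
    haveI : Fact (Nat.Prime 3) := ⟨Nat.prime_three⟩
    apply orderOf_eq_prime
    · rw [← map_pow]
      have : A ^ 3 = 1 := by
        apply Units.ext
        rw [hval, hω.pow_eq_one]
        ext i j; fin_cases i <;> fin_cases j <;> simp
      rw [this, map_one]
    · intro h
      rw [QuotientGroup.mk'_apply, QuotientGroup.eq_one_iff] at h
      exact diag_notMem_center ω (hω.ne_one (by norm_num)) A hA h
  have main : projAut F
      = Subgroup.zpowers (QuotientGroup.mk' (Subgroup.center (GL (Fin 3) K)) A) := by
    apply le_antisymm
    · rintro _ ⟨M, ⟨c, hc⟩, rfl⟩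
      rw [hF] at hc
      obtain ⟨a, z, ha, hz, hM⟩ := key α hα (M : Matrix (Fin 3) (Fin 3) K)
        ((M⁻¹ : GL (Fin 3) K) : Matrix (Fin 3) (Fin 3) K) c c.ne_zero
        (by exact_mod_cast Units.mul_inv M) (by exact_mod_cast Units.inv_mul M) hc
      have hza : (z / a) ^ 3 = 1 := by
        rw [div_pow, hz, div_self (pow_ne_zero _ ha)]
      obtain ⟨n, -, hn⟩ := hω.eq_pow_of_pow_eq_one hza
      refine ⟨n, ?_⟩
      simp only [zpow_natCast]
      rw [← map_pow, QuotientGroup.mk'_apply, QuotientGroup.mk'_apply, QuotientGroup.eq]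
      have hS : ((A ^ n)⁻¹ * M : GL (Fin 3) K).val = a • 1 := by
        have h1 : M.val = (A ^ n : GL (Fin 3) K).val * (a • 1) := by
          rw [hM, hval, hn]
          ext i j
          fin_cases i <;> fin_cases j <;> simp [ha]
        rw [Units.val_mul, h1, ← Matrix.mul_assoc, Units.inv_mul, Matrix.one_mul]
      exact mem_center_of_scalar _ a hS
    · rw [Subgroup.zpowers_le]
      refine ⟨A, ⟨1, ?_⟩, rfl⟩
      have h3 : (C ω : MvPolynomial (Fin 3) K) ^ 3 = 1 := by
        rw [← C_pow, hω.pow_eq_one, C_1]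
      rw [hA, hF]
      simp [substPoly, Fin.sum_univ_three, Matrix.diagonal_apply, MvPolynomial.smul_eq_C_mul,
        mul_pow]
      linear_combination (((C ω : MvPolynomial (Fin 3) K) ^ 3 + 1) * X 2 ^ 6
        + C α * X 2 ^ 3 * X 0 ^ 3) * h3
  refine ⟨main, ?_⟩
  rw [main, Nat.card_zpowers, hord]

end
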